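/- arXiv:1904.13104 — 3 statements merged into one kernel-verified Lean document; each statement's English description precedes it below -/
import Mathlib

section
/- For every $t\in[0,T]$ the solution has finite kinetic and elastic energy: the functions $x\mapsto(\partial_t u(t,x))^2$ and $x\mapsto\|\nabla_x u(t,x)\|^2$ are integrable on $\Omega\setminus\Gamma_t$. -/
open MeasureTheory

/-- `S(x₁,x₂) = (1/√2) · x₂ / √(|x| + x₁)` where `|x| = √(x₁² + x₂²)`. -/
noncomputable def S : ℝ × ℝ → ℝ := fun x =>
  (1 / Real.sqrt 2) * (x.2 / Real.sqrt (Real.sqrt (x.1 ^ 2 + x.2 ^ 2) + x.1))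

/-- The open ball `Ω = {|x| < R}`. -/
def Omega (R : ℝ) : Set (ℝ × ℝ) := {x | Real.sqrt (x.1 ^ 2 + x.2 ^ 2) < R}

/-- The crack at time `t`: `Γ_t = {(σ,0) ∈ Ω̄ : σ ≤ ct}`. -/
def Crack (R c t : ℝ) : Set (ℝ × ℝ) :=
  {x | Real.sqrt (x.1 ^ 2 + x.2 ^ 2) ≤ R ∧ x.2 = 0 ∧ x.1 ≤ c * t}

/-- `u(t,x) = (2/√π) S((x₁ - ct)/√(1-c²), x₂)`. -/
noncomputable def u (c t : ℝ) : ℝ × ℝ → ℝ := fun x =>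
  (2 / Real.sqrt Real.pi) * S ((x.1 - c * t) / Real.sqrt (1 - c ^ 2), x.2)

/-- The first partial derivative of `S` away from the horizontal axis. -/
noncomputable def S₁ (p : ℝ × ℝ) : ℝ :=
  -(1 / √2 * p.2 / (2 * √(p.1 ^ 2 + p.2 ^ 2) * √(√(p.1 ^ 2 + p.2 ^ 2) + p.1)))

/-- The second partial derivative of `S` away from the horizontal axis. -/
noncomputable def S₂ (p : ℝ × ℝ) : ℝ :=
  1 / √2 * √(√(p.1 ^ 2 + p.2 ^ 2) + p.1) / (2 * √(p.1 ^ 2 + p.2 ^ 2))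

lemma measurable_S₁ : Measurable S₁ := by unfold S₁; fun_prop

lemma measurable_S₂ : Measurable S₂ := by unfold S₂; fun_prop

lemma abs_lt_sqrt_sq_add_sq (x : ℝ) {y : ℝ} (hy : y ≠ 0) : |x| < √(x ^ 2 + y ^ 2) := by
  rw [← Real.sqrt_sq_eq_abs]
  exact Real.sqrt_lt_sqrt (sq_nonneg x) (by have := sq_pos_of_ne_zero hy; linarith)

lemma hasFDerivAt_S {p : ℝ × ℝ} (hp : p.2 ≠ 0) :
    HasFDerivAt S (S₁ p • ContinuousLinearMap.fst ℝ ℝ ℝ + S₂ p • ContinuousLinearMap.snd ℝ ℝ ℝ)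
      p := by
  have hlt := abs_lt_sqrt_sq_add_sq p.1 hp
  have hs : 0 < p.1 ^ 2 + p.2 ^ 2 := by positivity
  have hr : 0 < √(p.1 ^ 2 + p.2 ^ 2) := Real.sqrt_pos.2 hs
  have hw2 : 0 < √(p.1 ^ 2 + p.2 ^ 2) + p.1 := by linarith [(abs_lt.1 hlt).1]
  have hw : 0 < √(√(p.1 ^ 2 + p.2 ^ 2) + p.1) := Real.sqrt_pos.2 hw2
  have d1 : HasFDerivAt (fun q : ℝ × ℝ => q.1) (ContinuousLinearMap.fst ℝ ℝ ℝ) p := hasFDerivAt_fst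
  have d2 : HasFDerivAt (fun q : ℝ × ℝ => q.2) (ContinuousLinearMap.snd ℝ ℝ ℝ) p := hasFDerivAt_snd
  have dw := ((((d1.pow 2).add (d2.pow 2)).sqrt hs.ne').add d1).sqrt hw2.ne'
  have dS := (d2.mul ((hasDerivAt_inv hw.ne').comp_hasFDerivAt p dw)).const_mul (1 / √2)
  refine (dS.congr_of_eventuallyEq (.of_forall fun q => by
    simp [S, div_eq_mul_inv])).congr_fderiv ?_
  have hrr := Real.sq_sqrt hs.le
  have hww := Real.sq_sqrt hw2.le
  ext
  · simp [S₁]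
    set r := √(p.1 ^ 2 + p.2 ^ 2)
    set w := √(r + p.1)
    field_simp
    linear_combination hww
  · simp [S₂]
    set r := √(p.1 ^ 2 + p.2 ^ 2)
    set w := √(r + p.1)
    field_simp
    have h4 : w ^ 4 = (r + p.1) ^ 2 := by rw [← hww]; ring
    linear_combination (2 * r) * hww - h4 + hrr

lemma S₁_sq_le {p : ℝ × ℝ} (hp : p.2 ≠ 0) : S₁ p ^ 2 ≤ (√(p.1 ^ 2 + p.2 ^ 2))⁻¹ := by
  have hlt := abs_lt_sqrt_sq_add_sq p.1 hp
  have hs : 0 < p.1 ^ 2 + p.2 ^ 2 := by positivity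
  have hr : 0 < √(p.1 ^ 2 + p.2 ^ 2) := Real.sqrt_pos.2 hs
  have hw2 : 0 < √(p.1 ^ 2 + p.2 ^ 2) + p.1 := by linarith [(abs_lt.1 hlt).1]
  have hrr := Real.sq_sqrt hs.le
  simp only [S₁, neg_sq, div_pow, mul_pow, one_pow, Real.sq_sqrt hw2.le,
    Real.sq_sqrt zero_le_two]
  have := (abs_lt.1 hlt)
  set r := √(p.1 ^ 2 + p.2 ^ 2)
  rw [div_le_iff₀ (by positivity)]
  field_simp
  nlinarith

lemma S₂_sq_le {p : ℝ × ℝ} (hp : p.2 ≠ 0) : S₂ p ^ 2 ≤ (√(p.1 ^ 2 + p.2 ^ 2))⁻¹ := by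
  have hlt := abs_lt_sqrt_sq_add_sq p.1 hp
  have hs : 0 < p.1 ^ 2 + p.2 ^ 2 := by positivity
  have hr : 0 < √(p.1 ^ 2 + p.2 ^ 2) := Real.sqrt_pos.2 hs
  have hw2 : 0 < √(p.1 ^ 2 + p.2 ^ 2) + p.1 := by linarith [(abs_lt.1 hlt).1]
  simp only [S₂, div_pow, mul_pow, one_pow, Real.sq_sqrt hw2.le, Real.sq_sqrt zero_le_two]
  have := (abs_lt.1 hlt)
  set r := √(p.1 ^ 2 + p.2 ^ 2)
  rw [div_le_iff₀ (by positivity)]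
  field_simp
  nlinarith

lemma integrable_indicator_abs_rpow (M : ℝ) {r : ℝ} (hr : -1 < r) (hr0 : r ≠ 0) :
    Integrable ((Set.Icc (-M) M).indicator fun x : ℝ => |x| ^ r) := by
  have hf : Integrable ((Set.Ioc 0 M).indicator fun x : ℝ => x ^ r) := by
    rw [integrable_indicator_iff measurableSet_Ioc]
    exact (intervalIntegral.intervalIntegrable_rpow' hr (a := 0) (b := M)).1
  refine (hf.add hf.comp_neg).mono' ?_ (.of_forall fun x => ?_)
  · exact ((by fun_prop : Measurable fun x : ℝ => |x| ^ r).indicator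
      measurableSet_Icc).aestronglyMeasurable
  · by_cases hx : x ∈ Set.Icc (-M) M
    · rw [Set.indicator_of_mem hx, Real.norm_of_nonneg (by positivity)]
      rcases lt_trichotomy x 0 with h | rfl | h
      · have h1 : x ∉ Set.Ioc 0 M := fun h' => h'.1.not_gt h
        have h2 : -x ∈ Set.Ioc 0 M := ⟨by linarith, by linarith [hx.1]⟩
        simp [h1, h2, abs_of_neg h]
      · simp [Real.zero_rpow hr0]
      · have h1 : x ∈ Set.Ioc 0 M := ⟨h, hx.2⟩
        have h2 : -x ∉ Set.Ioc 0 M := fun h' => by linarith [h'.1]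
        simp [h1, h2, abs_of_pos h]
    · rw [Set.indicator_of_notMem hx, norm_zero]
      exact add_nonneg (Set.indicator_nonneg (fun y hy => Real.rpow_nonneg hy.1.le r) x)
        (Set.indicator_nonneg (fun y hy => Real.rpow_nonneg hy.1.le r) (-x))

lemma inv_sqrt_sq_add_sq_le {x y : ℝ} (hx : x ≠ 0) (hy : y ≠ 0) :
    (√(x ^ 2 + y ^ 2))⁻¹ ≤ |x| ^ (-(1 / 2) : ℝ) * |y| ^ (-(1 / 2) : ℝ) := by
  rw [Real.rpow_neg (abs_nonneg x), Real.rpow_neg (abs_nonneg y), ← Real.sqrt_eq_rpow,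
    ← Real.sqrt_eq_rpow, ← mul_inv, ← Real.sqrt_mul (abs_nonneg x)]
  have hx' := abs_pos.2 hx
  have hy' := abs_pos.2 hy
  gcongr
  rw [← sq_abs x, ← sq_abs y]
  nlinarith [sq_nonneg (|x| - |y|), mul_pos hx' hy']

lemma ae_fst_ne (b : ℝ) : ∀ᵐ x : ℝ × ℝ, x.1 ≠ b :=
  Measure.quasiMeasurePreserving_fst.ae (compl_mem_ae_iff.2 (measure_singleton b))

lemma ae_snd_ne (b : ℝ) : ∀ᵐ x : ℝ × ℝ, x.2 ≠ b :=
  Measure.quasiMeasurePreserving_snd.ae (compl_mem_ae_iff.2 (measure_singleton b))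

lemma measurableSet_Omega (R : ℝ) : MeasurableSet (Omega R) :=
  measurableSet_lt (by fun_prop) measurable_const

lemma integrableOn_inv_sqrt (R b : ℝ) {a : ℝ} (ha : 0 < a) :
    IntegrableOn (fun x : ℝ × ℝ => (√(((x.1 - b) / a) ^ 2 + x.2 ^ 2))⁻¹) (Omega R) := by
  have hX := ((integrable_indicator_abs_rpow ((R + |b|) / a) (r := -(1 / 2)) (by norm_num)
    (by norm_num)).comp_div ha.ne').comp_sub_right b
  have hY := integrable_indicator_abs_rpow R (r := -(1 / 2)) (by norm_num) (by norm_num)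
  refine (hX.mul_prod hY).integrableOn.mono' (by fun_prop) ?_
  filter_upwards [ae_restrict_of_ae (ae_fst_ne b), ae_restrict_of_ae (ae_snd_ne 0),
    ae_restrict_mem (measurableSet_Omega R)] with x hx hy hR
  have hR : √(x.1 ^ 2 + x.2 ^ 2) < R := hR
  have h1 : |x.1| ≤ R := (Real.abs_le_sqrt (by nlinarith)).trans hR.le
  have h2 : |x.2| ≤ R := (Real.abs_le_sqrt (by nlinarith)).trans hR.le
  have h3 : |(x.1 - b) / a| ≤ (R + |b|) / a := by
    rw [abs_div, abs_of_pos ha]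
    gcongr
    exact (abs_sub _ _).trans (by gcongr)
  rw [Set.indicator_of_mem (Set.mem_Icc.2 (abs_le.1 h3)),
    Set.indicator_of_mem (Set.mem_Icc.2 (abs_le.1 h2)),
    Real.norm_of_nonneg (by positivity)]
  exact inv_sqrt_sq_add_sq_le (div_ne_zero (sub_ne_zero.2 hx) ha.ne') hy

lemma integrableOn_sq_of_le {g : ℝ × ℝ → ℝ} (hg : Measurable g)
    (hle : ∀ p : ℝ × ℝ, p.2 ≠ 0 → g p ^ 2 ≤ (√(p.1 ^ 2 + p.2 ^ 2))⁻¹)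
    (R b : ℝ) {a : ℝ} (ha : 0 < a) :
    IntegrableOn (fun x : ℝ × ℝ => g ((x.1 - b) / a, x.2) ^ 2) (Omega R) := by
  have hm : Measurable fun x : ℝ × ℝ => g ((x.1 - b) / a, x.2) ^ 2 :=
    (hg.comp (by fun_prop)).pow_const 2
  refine (integrableOn_inv_sqrt R b ha).mono' hm.aestronglyMeasurable ?_
  filter_upwards [ae_restrict_of_ae (ae_snd_ne 0)] with x hx
  rw [Real.norm_of_nonneg (sq_nonneg _)]
  exact hle ((x.1 - b) / a, x.2) hx

lemma hasDerivAt_u (c t : ℝ) {x : ℝ × ℝ} (hx : x.2 ≠ 0) :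
    HasDerivAt (fun s : ℝ => u c s x)
      (2 / √Real.pi * (S₁ ((x.1 - c * t) / √(1 - c ^ 2), x.2) * (-c / √(1 - c ^ 2)))) t := by
  have h1 : HasDerivAt (fun s : ℝ => ((x.1 - c * s) / √(1 - c ^ 2), x.2))
      (-c / √(1 - c ^ 2), 0) t := by
    refine HasDerivAt.prodMk ?_ (hasDerivAt_const _ _)
    simpa using (((hasDerivAt_id t).const_mul c).const_sub x.1).div_const √(1 - c ^ 2)
  have h2 : HasFDerivAt S _ ((x.1 - c * t) / √(1 - c ^ 2), x.2) := hasFDerivAt_S hx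
  simpa [u] using (h2.comp_hasDerivAt t h1).const_mul (2 / √Real.pi)

lemma hasFDerivAt_u (c t : ℝ) {x : ℝ × ℝ} (hx : x.2 ≠ 0) :
    HasFDerivAt (u c t)
      ((2 / √Real.pi * S₁ ((x.1 - c * t) / √(1 - c ^ 2), x.2) / √(1 - c ^ 2)) •
          ContinuousLinearMap.fst ℝ ℝ ℝ +
        (2 / √Real.pi * S₂ ((x.1 - c * t) / √(1 - c ^ 2), x.2)) •
          ContinuousLinearMap.snd ℝ ℝ ℝ) x := by
  have h1 : HasFDerivAt (fun y : ℝ × ℝ => ((y.1 - c * t) / √(1 - c ^ 2), y.2)) _ x :=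
    (((hasFDerivAt_fst (𝕜 := ℝ) (p := x)).sub_const (c * t)).mul_const (√(1 - c ^ 2))⁻¹).prodMk
      (hasFDerivAt_snd (𝕜 := ℝ) (p := x))
  have h2 : HasFDerivAt S _ ((x.1 - c * t) / √(1 - c ^ 2), x.2) := hasFDerivAt_S hx
  refine ((h2.comp x h1).const_mul (2 / √Real.pi)).congr_fderiv ?_
  ext
  · simp
    ring
  · simp

/-- For every `t ∈ [0,T]` the solution has finite kinetic and elastic energy:
`(∂ₜu(t,·))²` and `‖∇ₓu(t,·)‖²` are integrable on `Ω \ Γ_t`. -/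
theorem u_finite_energy (c T R : ℝ) (hc0 : 0 < c) (hc1 : c < 1) (hT : 0 < T)
    (hR : c * T < R) :
    ∀ t ∈ Set.Icc (0 : ℝ) T,
      IntegrableOn (fun x : ℝ × ℝ => (deriv (fun s : ℝ => u c s x) t) ^ 2)
        (Omega R \ Crack R c t) volume ∧
      IntegrableOn
        (fun x : ℝ × ℝ => (fderiv ℝ (u c t) x (1, 0)) ^ 2 + (fderiv ℝ (u c t) x (0, 1)) ^ 2)
        (Omega R \ Crack R c t) volume := by
  intro t _
  have ha : 0 < √(1 - c ^ 2) := Real.sqrt_pos.2 (by nlinarith)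
  have I₁ := integrableOn_sq_of_le measurable_S₁ (fun _ => S₁_sq_le) R (c * t) ha
  have I₂ := integrableOn_sq_of_le measurable_S₂ (fun _ => S₂_sq_le) R (c * t) ha
  constructor
  · refine IntegrableOn.mono_set ?_ Set.sdiff_subset
    refine (I₁.const_mul ((2 / √Real.pi * (-c / √(1 - c ^ 2))) ^ 2)).congr ?_
    filter_upwards [ae_restrict_of_ae (ae_snd_ne 0)] with x hx
    rw [(hasDerivAt_u c t hx).deriv]
    ring
  · refine IntegrableOn.mono_set ?_ Set.sdiff_subset
    refine ((I₁.const_mul ((2 / √Real.pi / √(1 - c ^ 2)) ^ 2)).add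
      (I₂.const_mul ((2 / √Real.pi) ^ 2))).congr ?_
    filter_upwards [ae_restrict_of_ae (ae_snd_ne 0)] with x hx
    rw [(hasFDerivAt_u c t hx).fderiv]
    simp
    ring
end

section
/- $u$ is a weak (distributional) solution of the wave equation with homogeneous Neumann conditions on the moving crack: for every smooth test function $\varphi:\mathbb{R}\times\mathbb{R}^2\to\mathbb{R}$ with compact support contained in $(0,T)\times\Omega$ (NOT required to vanish on the cracks $\Gamma_t$), one has $\int_0^T\!\!\int_{\Omega}\big(\partial_t u(t,x)\,\partial_t\varphi(t,x)-\nabla_x u(t,x)\cdot\nabla_x\varphi(t,x)\big)\,dx\,dt=0$, where the derivatives of $u$ are the classical ones defined for $x\notin\Gamma_t$ (a set of full measure for each $t$). -/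
open MeasureTheory

/-- `√2` times the real part of the principal square root of `a + ib`; its harmonic conjugate is
`√2 • S`. -/
noncomputable def sqrtRe (a b : ℝ) : ℝ := √(√(a ^ 2 + b ^ 2) + a)

/-- The derivative of `sqrtRe` in the first variable. -/
noncomputable def sqrtReFst (a b : ℝ) : ℝ := sqrtRe a b / (2 * √(a ^ 2 + b ^ 2))

/-- The derivative of `sqrtRe` in the second variable. -/
noncomputable def sqrtReSnd (a b : ℝ) : ℝ := b / (2 * √(a ^ 2 + b ^ 2) * sqrtRe a b)

lemma sqrt_sq_add_sq_pos (a : ℝ) {b : ℝ} (hb : b ≠ 0) : 0 < √(a ^ 2 + b ^ 2) :=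
  Real.sqrt_pos.2 (by positivity)

lemma sqrt_sq_add_sq_add_pos (a : ℝ) {b : ℝ} (hb : b ≠ 0) : 0 < √(a ^ 2 + b ^ 2) + a := by
  have h : |a| < √(a ^ 2 + b ^ 2) := by
    rw [← Real.sqrt_sq_eq_abs]
    exact Real.sqrt_lt_sqrt (by positivity) (by linarith [sq_pos_of_ne_zero hb])
  linarith [neg_abs_le a]

lemma sqrtRe_pos (a : ℝ) {b : ℝ} (hb : b ≠ 0) : 0 < sqrtRe a b :=
  Real.sqrt_pos.2 (sqrt_sq_add_sq_add_pos a hb)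

lemma sqrtRe_sq (a : ℝ) {b : ℝ} (hb : b ≠ 0) : sqrtRe a b ^ 2 = √(a ^ 2 + b ^ 2) + a :=
  Real.sq_sqrt (sqrt_sq_add_sq_add_pos a hb).le

lemma sq_sqrt_sq_add_sq (a b : ℝ) : √(a ^ 2 + b ^ 2) ^ 2 = a ^ 2 + b ^ 2 :=
  Real.sq_sqrt (by positivity)

lemma hasDerivAt_sqrtRe_fst (a : ℝ) {b : ℝ} (hb : b ≠ 0) :
    HasDerivAt (fun x => sqrtRe x b) (sqrtReFst a b) a := by
  have hr := sqrt_sq_add_sq_pos a hb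
  have hq := sqrtRe_pos a hb
  have h1 : HasDerivAt (fun x : ℝ => x ^ 2 + b ^ 2) (2 * a) a := by
    simpa using ((hasDerivAt_id a).pow 2).add_const (b ^ 2)
  have h2 := ((h1.sqrt (by positivity)).add (hasDerivAt_id a)).sqrt
    (sqrt_sq_add_sq_add_pos a hb).ne'
  refine h2.congr_deriv ?_
  have e := sqrtRe_sq a hb
  simp only [Pi.add_apply, id, sqrtReFst]
  change _ / (2 * sqrtRe a b) = _
  field_simp
  linarith

lemma hasDerivAt_sqrtRe_snd (a : ℝ) {b : ℝ} (hb : b ≠ 0) :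
    HasDerivAt (sqrtRe a) (sqrtReSnd a b) b := by
  have hr := sqrt_sq_add_sq_pos a hb
  have hq := sqrtRe_pos a hb
  have h1 : HasDerivAt (fun x : ℝ => a ^ 2 + x ^ 2) (2 * b) b := by
    simpa using ((hasDerivAt_id b).pow 2).const_add (a ^ 2)
  have h2 := ((h1.sqrt (by positivity)).add_const a).sqrt (sqrt_sq_add_sq_add_pos a hb).ne'
  refine h2.congr_deriv ?_
  simp only [sqrtReSnd]
  change _ / (2 * sqrtRe a b) = _
  field_simp

lemma continuous_sqrtRe : Continuous fun p : ℝ × ℝ => sqrtRe p.1 p.2 := by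
  unfold sqrtRe; fun_prop

lemma abs_le_sqrt_sq_add_sq (a b : ℝ) : |b| ≤ √(a ^ 2 + b ^ 2) := by
  rw [← Real.sqrt_sq_eq_abs]
  exact Real.sqrt_le_sqrt (by linarith [sq_nonneg a])

lemma le_sqrt_sq_add_sq (a b : ℝ) : a ≤ √(a ^ 2 + b ^ 2) :=
  Real.le_sqrt_of_sq_le (by linarith [sq_nonneg b])

lemma neg_le_sqrt_sq_add_sq (a b : ℝ) : -a ≤ √(a ^ 2 + b ^ 2) :=
  Real.le_sqrt_of_sq_le (by linarith [sq_nonneg b, neg_sq a])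

lemma abs_sqrtReFst_le (a : ℝ) {b : ℝ} (hb : b ≠ 0) : |sqrtReFst a b| ≤ 1 / √|b| := by
  have hr := sqrt_sq_add_sq_pos a hb
  have hq := sqrtRe_pos a hb
  have hm : 0 < √|b| := Real.sqrt_pos.2 (abs_pos.2 hb)
  rw [abs_of_nonneg (by unfold sqrtReFst; positivity), sqrtReFst, div_le_div_iff₀ (by positivity) hm]
  have e1 := sqrtRe_sq a hb
  have e2 := Real.sq_sqrt (abs_nonneg b)
  have e3 := abs_le_sqrt_sq_add_sq a b
  have e4 := le_sqrt_sq_add_sq a b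
  nlinarith [sq_nonneg (sqrtRe a b - √|b|)]

lemma abs_sqrtReSnd_le (a : ℝ) {b : ℝ} (hb : b ≠ 0) : |sqrtReSnd a b| ≤ 1 / √|b| := by
  have hr := sqrt_sq_add_sq_pos a hb
  have hq := sqrtRe_pos a hb
  have hm : 0 < √|b| := Real.sqrt_pos.2 (abs_pos.2 hb)
  have e1 := sqrtRe_sq a hb
  have e2 := Real.sq_sqrt (abs_nonneg b)
  have e3 := abs_le_sqrt_sq_add_sq a b
  have e4 := le_sqrt_sq_add_sq a b
  have e5 := neg_le_sqrt_sq_add_sq a b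
  have e6 := sq_sqrt_sq_add_sq a b
  have e7 : |b| = √(√(a ^ 2 + b ^ 2) - a) * sqrtRe a b := by
    rw [sqrtRe, ← Real.sqrt_mul (by linarith), ← Real.sqrt_sq_eq_abs]
    congr 1
    linarith
  have e8 : √(√(a ^ 2 + b ^ 2) - a) ^ 2 = √(a ^ 2 + b ^ 2) - a := Real.sq_sqrt (by linarith)
  have e9 : √(√(a ^ 2 + b ^ 2) - a) * √|b| ≤ 2 * √(a ^ 2 + b ^ 2) := by
    nlinarith [sq_nonneg (√(√(a ^ 2 + b ^ 2) - a) - √|b|)]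
  rw [sqrtReSnd, abs_div, abs_of_pos (a := 2 * √(a ^ 2 + b ^ 2) * sqrtRe a b) (by positivity),
    div_le_div_iff₀ (by positivity) hm]
  calc |b| * √|b| = (√(√(a ^ 2 + b ^ 2) - a) * √|b|) * sqrtRe a b := by nth_rw 1 [e7]; ring
    _ ≤ 1 * (2 * √(a ^ 2 + b ^ 2) * sqrtRe a b) := by
      rw [one_mul]; exact mul_le_mul_of_nonneg_right e9 hq.le

lemma measurable_sqrtReFst : Measurable fun p : ℝ × ℝ => sqrtReFst p.1 p.2 := by
  unfold sqrtReFst sqrtRe; fun_prop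

lemma measurable_sqrtReSnd : Measurable fun p : ℝ × ℝ => sqrtReSnd p.1 p.2 := by
  unfold sqrtReSnd sqrtRe; fun_prop

/-- One of the Cauchy-Riemann equations relating `√2 • S = b / sqrtRe a b` and `sqrtRe`. -/
lemma hasDerivAt_div_sqrtRe_fst (a : ℝ) {b : ℝ} (hb : b ≠ 0) :
    HasDerivAt (fun x => b / sqrtRe x b) (-sqrtReSnd a b) a := by
  have hr := sqrt_sq_add_sq_pos a hb
  have hq := sqrtRe_pos a hb
  refine ((hasDerivAt_const a b).div (hasDerivAt_sqrtRe_fst a hb) hq.ne').congr_deriv ?_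
  unfold sqrtReFst sqrtReSnd
  field_simp
  ring

lemma hasDerivAt_div_sqrtRe_snd (a : ℝ) {b : ℝ} (hb : b ≠ 0) :
    HasDerivAt (fun y => y / sqrtRe a y) (sqrtReFst a b) b := by
  have hr := sqrt_sq_add_sq_pos a hb
  have hq := sqrtRe_pos a hb
  refine ((hasDerivAt_id b).div (hasDerivAt_sqrtRe_snd a hb) hq.ne').congr_deriv ?_
  have e1 := sqrtRe_sq a hb
  have e2 := sq_sqrt_sq_add_sq a b
  simp only [sqrtReFst, sqrtReSnd, id]
  field_simp
  have e3 : b ^ 2 = (√(a ^ 2 + b ^ 2) - a) * sqrtRe a b ^ 2 := by rw [e1]; nlinarith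
  nlinarith

lemma integral_eq_zero_of_hasDerivAt_off_countable {h h' : ℝ → ℝ} {s : Set ℝ} (hs : s.Countable)
    (hc : Continuous h) {N : ℝ} (hN : ∀ x, N < |x| → h x = 0)
    (hd : ∀ x ∉ s, HasDerivAt h (h' x) x) : ∫ x, h' x = 0 := by
  by_cases hi : Integrable h'
  swap
  · exact integral_undef hi
  have h0 : ∀ x, |N| + 1 ≤ |x| → h x = 0 := fun x hx => hN x (by linarith [le_abs_self N])
  have hzero : ∀ x ∉ s, x ∉ Set.Ioc (-(|N| + 1)) (|N| + 1) → h' x = 0 := by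
    intro x hxs hx
    have hlt : N < |x| := by
      by_contra! hle
      have := abs_le.1 (hle.trans (le_abs_self N))
      exact hx ⟨by linarith, by linarith⟩
    have : h =ᶠ[nhds x] fun _ => 0 := by
      filter_upwards [(isOpen_lt continuous_const continuous_abs).mem_nhds hlt] with y hy
      exact hN y hy
    exact (hd x hxs).unique ((hasDerivAt_const x (0 : ℝ)).congr_of_eventuallyEq this)
  have hpos : 0 ≤ |N| := abs_nonneg N
  calc ∫ x, h' x = ∫ x in Set.Ioc (-(|N| + 1)) (|N| + 1), h' x := by
        refine (setIntegral_eq_integral_of_ae_compl_eq_zero ?_).symm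
        filter_upwards [hs.ae_notMem volume] with x hx hx'
        exact hzero x hx hx'
    _ = ∫ x in (-(|N| + 1))..(|N| + 1), h' x := by
        rw [intervalIntegral.integral_of_le (by linarith)]
    _ = h (|N| + 1) - h (-(|N| + 1)) :=
        integral_eq_of_hasDerivAt_off_countable h h' hs hc.continuousOn
          (fun x hx => hd x hx.2) hi.intervalIntegrable
    _ = 0 := by
        rw [h0 _ (le_abs_self _), h0 _ (by rw [abs_neg]; exact le_abs_self _), sub_zero]

lemma exists_bound_of_hasCompactSupport {ψ : ℝ × (ℝ × ℝ) → ℝ} (hψ : HasCompactSupport ψ) :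
    ∃ N, ∀ p, N < |p.1| ∨ N < |p.2.1| ∨ N < |p.2.2| → ψ p = 0 := by
  obtain ⟨N, hN⟩ := hψ.isCompact.isBounded.exists_norm_le
  refine ⟨N, fun p hp => ?_⟩
  by_contra h
  have h1 := hN p (subset_tsupport _ h)
  simp only [Prod.norm_def, Real.norm_eq_abs, sup_le_iff] at h1
  rcases hp with hp | hp | hp <;> linarith [h1.1, h1.2.1, h1.2.2]

lemma integrableOn_one_div_sqrt_abs (N : ℝ) :
    IntegrableOn (fun x : ℝ => 1 / √|x|) (Set.Icc (-N) N) := by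
  rcases lt_or_ge N 0 with hN | hN
  · simp [Set.Icc_eq_empty (a := -N) (b := N) (by linarith)]
  have h (a b : ℝ) : IntervalIntegrable (fun x : ℝ => x ^ (-(1 / 2) : ℝ)) volume a b :=
    intervalIntegral.intervalIntegrable_rpow' (by norm_num)
  have h2 := (h N (-N)).comp_sub_left 0
  simp only [zero_sub, neg_neg] at h2
  have h3 := ((intervalIntegrable_iff_integrableOn_Icc_of_le (by linarith)).1 (h (-N) N)).norm.add
    ((intervalIntegrable_iff_integrableOn_Icc_of_le (by linarith)).1 h2).norm
  refine h3.mono' (Measurable.aestronglyMeasurable (by fun_prop)) (Filter.Eventually.of_forall fun x => ?_)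
  have key : ∀ y : ℝ, 0 ≤ y → 1 / √|y| = ‖y ^ (-(1 / 2) : ℝ)‖ := fun y hy => by
    rw [Real.norm_of_nonneg (by positivity), Real.rpow_neg hy, abs_of_nonneg hy,
      ← Real.sqrt_eq_rpow, one_div]
  rw [Real.norm_of_nonneg (by positivity), Pi.add_apply]
  rcases le_total 0 x with hx | hx
  · rw [key x hx]; exact le_add_of_nonneg_right (norm_nonneg _)
  · rw [← abs_neg, key (-x) (by linarith)]; exact le_add_of_nonneg_left (norm_nonneg _)

lemma ae_snd_ne_zero : ∀ᵐ x : ℝ × ℝ, x.2 ≠ 0 :=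
  Measure.quasiMeasurePreserving_snd.ae (Measure.ae_ne volume (0 : ℝ))

lemma ae_snd_snd_ne_zero : ∀ᵐ p : ℝ × (ℝ × ℝ), p.2.2 ≠ 0 :=
  Measure.quasiMeasurePreserving_snd.ae ae_snd_ne_zero

/-- A measurable function with an inverse square root singularity at `x₂ = 0` is integrable against
continuous compactly supported functions. -/
lemma integrable_mul_of_le_one_div_sqrt {W ψ : ℝ × (ℝ × ℝ) → ℝ} (hW : Measurable W) {M : ℝ}
    (hM : ∀ p, p.2.2 ≠ 0 → |W p| ≤ M * (1 / √|p.2.2|)) (hψ : Continuous ψ)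
    (hc : HasCompactSupport ψ) : Integrable fun p => W p * ψ p := by
  obtain ⟨N, hN⟩ := exists_bound_of_hasCompactSupport hc
  obtain ⟨L, hL⟩ := hψ.bounded_above_of_compact_support hc
  have hI : Integrable ((Set.Icc (-N) N).indicator fun _ => (1 : ℝ)) :=
    (integrable_indicator_iff measurableSet_Icc).2 (by simp)
  have hJ : Integrable ((Set.Icc (-N) N).indicator fun x : ℝ => 1 / √|x|) :=
    (integrable_indicator_iff measurableSet_Icc).2 (integrableOn_one_div_sqrt_abs N)
  have hB := (hI.mul_prod (hI.mul_prod hJ)).const_mul (M * L)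
  refine hB.mono' (hW.mul hψ.measurable).aestronglyMeasurable ?_
  filter_upwards [ae_snd_snd_ne_zero] with p hp
  by_cases h : |p.1| ≤ N ∧ |p.2.1| ≤ N ∧ |p.2.2| ≤ N
  · have hmem {x : ℝ} (hx : |x| ≤ N) : x ∈ Set.Icc (-N) N := abs_le.1 hx
    rw [Set.indicator_of_mem (hmem h.1), Set.indicator_of_mem (hmem h.2.1),
      Set.indicator_of_mem (hmem h.2.2), norm_mul, one_mul, one_mul]
    calc ‖W p‖ * ‖ψ p‖ ≤ M * (1 / √|p.2.2|) * L :=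
          mul_le_mul (hM p hp) (hL p) (norm_nonneg _) ((abs_nonneg _).trans (hM p hp))
      _ = M * L * (1 / √|p.2.2|) := by ring
  · have h0 : ψ p = 0 := hN p (by by_contra! h'; exact h h')
    have hM0 : 0 ≤ M := nonneg_of_mul_nonneg_left ((abs_nonneg _).trans (hM p hp))
      (by have := abs_pos.2 hp; positivity)
    have hL0 : 0 ≤ L := (norm_nonneg _).trans (hL p)
    rw [h0, mul_zero, norm_zero]
    have hi (f : ℝ → ℝ) (hf : ∀ x, 0 ≤ f x) (x : ℝ) : 0 ≤ (Set.Icc (-N) N).indicator f x :=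
      Set.indicator_nonneg (fun x _ => hf x) x
    exact mul_nonneg (mul_nonneg hM0 hL0) (mul_nonneg (hi _ (by simp) _)
      (mul_nonneg (hi _ (by simp) _) (hi _ (fun x => by positivity) _)))

section Directions

variable {D W ψ : ℝ × (ℝ × ℝ) → ℝ}

lemma integral_deriv_time_eq_zero (hD : Continuous D) (hψ : ContDiff ℝ 1 ψ)
    (hc : HasCompactSupport ψ)
    (hd : ∀ p : ℝ × (ℝ × ℝ), p.2.2 ≠ 0 → HasDerivAt (fun s => D (s, p.2)) (W p) p.1)
    (hi : Integrable fun p => W p * ψ p + D p * fderiv ℝ ψ p (1, 0)) :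
    ∫ p, (W p * ψ p + D p * fderiv ℝ ψ p (1, 0)) = 0 := by
  obtain ⟨N, hN⟩ := exists_bound_of_hasCompactSupport hc
  have hψc := hψ.continuous
  rw [Measure.volume_eq_prod] at hi ⊢
  rw [integral_prod_symm _ hi]
  refine integral_eq_zero_of_ae ?_
  filter_upwards [ae_snd_ne_zero] with x hx
  refine integral_eq_zero_of_hasDerivAt_off_countable (h := fun s => D (s, x) * ψ (s, x))
    Set.countable_empty (by fun_prop) (N := N) (fun s hs => by simp [hN (s, x) (Or.inl hs)])
    fun s _ => ?_
  have h2 : HasDerivAt (fun s => ψ (s, x)) (fderiv ℝ ψ (s, x) (1, 0)) s :=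
    ((hψ.differentiable one_ne_zero (s, x)).hasFDerivAt).comp_hasDerivAt s
      ((hasDerivAt_id s).prodMk (hasDerivAt_const s x))
  exact (hd (s, x) hx).mul h2

lemma integral_deriv_fst_eq_zero (hD : Continuous D) (hψ : ContDiff ℝ 1 ψ)
    (hc : HasCompactSupport ψ)
    (hd : ∀ p : ℝ × (ℝ × ℝ), p.2.2 ≠ 0 → HasDerivAt (fun s => D (p.1, s, p.2.2)) (W p) p.2.1)
    (hi : Integrable fun p => W p * ψ p + D p * fderiv ℝ ψ p (0, 1, 0)) :
    ∫ p, (W p * ψ p + D p * fderiv ℝ ψ p (0, 1, 0)) = 0 := by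
  obtain ⟨N, hN⟩ := exists_bound_of_hasCompactSupport hc
  have hψc := hψ.continuous
  rw [Measure.volume_eq_prod] at hi ⊢
  rw [integral_prod _ hi]
  refine integral_eq_zero_of_ae ?_
  filter_upwards [hi.prod_right_ae] with t ht
  rw [Measure.volume_eq_prod] at ht ⊢
  rw [integral_prod_symm _ ht]
  refine integral_eq_zero_of_ae ?_
  filter_upwards [Measure.ae_ne volume (0 : ℝ)] with y hy
  refine integral_eq_zero_of_hasDerivAt_off_countable (h := fun s => D (t, s, y) * ψ (t, s, y))
    Set.countable_empty (by fun_prop) (N := N)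
    (fun s hs => by simp [hN (t, s, y) (Or.inr (Or.inl hs))]) fun s _ => ?_
  have h2 : HasDerivAt (fun s => ψ (t, s, y)) (fderiv ℝ ψ (t, s, y) (0, 1, 0)) s :=
    ((hψ.differentiable one_ne_zero (t, s, y)).hasFDerivAt).comp_hasDerivAt s
      ((hasDerivAt_const s t).prodMk ((hasDerivAt_id s).prodMk (hasDerivAt_const s y)))
  exact (hd (t, s, y) hy).mul h2

lemma integral_deriv_snd_eq_zero (hD : Continuous D) (hψ : ContDiff ℝ 1 ψ)
    (hc : HasCompactSupport ψ)
    (hd : ∀ p : ℝ × (ℝ × ℝ), p.2.2 ≠ 0 → HasDerivAt (fun s => D (p.1, p.2.1, s)) (W p) p.2.2)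
    (hi : Integrable fun p => W p * ψ p + D p * fderiv ℝ ψ p (0, 0, 1)) :
    ∫ p, (W p * ψ p + D p * fderiv ℝ ψ p (0, 0, 1)) = 0 := by
  obtain ⟨N, hN⟩ := exists_bound_of_hasCompactSupport hc
  have hψc := hψ.continuous
  rw [Measure.volume_eq_prod] at hi ⊢
  rw [integral_prod _ hi]
  refine integral_eq_zero_of_ae ?_
  filter_upwards [hi.prod_right_ae] with t ht
  rw [Measure.volume_eq_prod] at ht ⊢
  rw [integral_prod _ ht]
  refine integral_eq_zero_of_ae (Filter.Eventually.of_forall fun y => ?_)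
  refine integral_eq_zero_of_hasDerivAt_off_countable (h := fun s => D (t, y, s) * ψ (t, y, s))
    (Set.countable_singleton 0) (by fun_prop) (N := N)
    (fun s hs => by simp [hN (t, y, s) (Or.inr (Or.inr hs))]) fun s hs => ?_
  have h2 : HasDerivAt (fun s => ψ (t, y, s)) (fderiv ℝ ψ (t, y, s) (0, 0, 1)) s :=
    ((hψ.differentiable one_ne_zero (t, y, s)).hasFDerivAt).comp_hasDerivAt s
      ((hasDerivAt_const s t).prodMk ((hasDerivAt_const s y).prodMk (hasDerivAt_id s)))
  exact (hd (t, y, s) hs).mul h2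

end Directions

lemma u_eq (c t : ℝ) (x : ℝ × ℝ) :
    u c t x = 2 / √Real.pi * (1 / √2) * (x.2 / sqrtRe ((x.1 - c * t) / √(1 - c ^ 2)) x.2) := by
  simp only [u, S, sqrtRe]; ring

lemma differentiableAt_u (c t : ℝ) {x : ℝ × ℝ} (hx : x.2 ≠ 0) : DifferentiableAt ℝ (u c t) x := by
  have hr : DifferentiableAt ℝ
      (fun y : ℝ × ℝ => √(((y.1 - c * t) / √(1 - c ^ 2)) ^ 2 + y.2 ^ 2)) x :=
    .sqrt (by fun_prop) (Real.sqrt_pos.1 (sqrt_sq_add_sq_pos _ hx)).ne'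
  have hq : DifferentiableAt ℝ
      (fun y : ℝ × ℝ => sqrtRe ((y.1 - c * t) / √(1 - c ^ 2)) y.2) x :=
    .sqrt (hr.add (by fun_prop)) (sqrt_sq_add_sq_add_pos _ hx).ne'
  rw [funext (u_eq c t)]
  simp only [div_eq_mul_inv _ (sqrtRe _ _)]
  exact (differentiableAt_snd.fun_mul (hq.fun_inv (sqrtRe_pos _ hx).ne')).const_mul _

lemma deriv_u_time (c t : ℝ) {x : ℝ × ℝ} (hx : x.2 ≠ 0) :
    deriv (fun s => u c s x) t = 2 / √Real.pi * (1 / √2) *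
      (c / √(1 - c ^ 2) * sqrtReSnd ((x.1 - c * t) / √(1 - c ^ 2)) x.2) := by
  simp only [u_eq]
  have h : HasDerivAt (fun s => (x.1 - c * s) / √(1 - c ^ 2)) (-c / √(1 - c ^ 2)) t := by
    simpa using (((hasDerivAt_id t).const_mul c).const_sub x.1).div_const (√(1 - c ^ 2))
  have := ((hasDerivAt_div_sqrtRe_fst _ hx).comp t h).const_mul (2 / √Real.pi * (1 / √2))
  refine this.deriv.trans ?_
  ring

lemma fderiv_u_fst (c t : ℝ) {x : ℝ × ℝ} (hx : x.2 ≠ 0) :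
    fderiv ℝ (u c t) x (1, 0) = 2 / √Real.pi * (1 / √2) *
      (-1 / √(1 - c ^ 2) * sqrtReSnd ((x.1 - c * t) / √(1 - c ^ 2)) x.2) := by
  have h0 := (differentiableAt_u c t hx).hasFDerivAt.comp_hasDerivAt x.1
    ((hasDerivAt_id x.1).prodMk (hasDerivAt_const x.1 x.2))
  have h : HasDerivAt (fun s => (s - c * t) / √(1 - c ^ 2)) (1 / √(1 - c ^ 2)) x.1 :=
    ((hasDerivAt_id x.1).sub_const (c * t)).div_const (√(1 - c ^ 2))
  have := ((hasDerivAt_div_sqrtRe_fst _ hx).comp x.1 h).const_mul (2 / √Real.pi * (1 / √2))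
  refine (h0.unique (this.congr_of_eventuallyEq (.of_forall fun s => u_eq c t (s, x.2)))).trans ?_
  ring

lemma fderiv_u_snd (c t : ℝ) {x : ℝ × ℝ} (hx : x.2 ≠ 0) :
    fderiv ℝ (u c t) x (0, 1) = 2 / √Real.pi * (1 / √2) *
      sqrtReFst ((x.1 - c * t) / √(1 - c ^ 2)) x.2 := by
  have h0 := (differentiableAt_u c t hx).hasFDerivAt.comp_hasDerivAt x.2
    ((hasDerivAt_const x.2 x.1).prodMk (hasDerivAt_id x.2))
  have := (hasDerivAt_div_sqrtRe_snd ((x.1 - c * t) / √(1 - c ^ 2)) hx).const_mul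
    (2 / √Real.pi * (1 / √2))
  exact h0.unique (this.congr_of_eventuallyEq (.of_forall fun s => u_eq c t (x.1, s)))

/-- `u` is a weak (distributional) solution of the wave equation with homogeneous
Neumann conditions on the moving crack: for every smooth test function `φ` with
compact support contained in `(0,T) × Ω` (not required to vanish on the cracks),
`∫₀ᵀ ∫_Ω (∂ₜu ∂ₜφ - ∇ₓu · ∇ₓφ) dx dt = 0`, where the derivatives of `u` are the
classical ones, defined off the crack (a set of full measure for each `t`). -/
theorem u_weak_solution_wave (c T R : ℝ) (hc0 : 0 < c) (hc1 : c < 1) (hT : 0 < T)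
    (hR : c * T < R) :
    ∀ φ : ℝ × (ℝ × ℝ) → ℝ, ContDiff ℝ (⊤ : ℕ∞) φ → HasCompactSupport φ →
      tsupport φ ⊆ Set.Ioo (0 : ℝ) T ×ˢ Omega R →
      (∫ t in Set.Ioo (0 : ℝ) T, ∫ x in Omega R,
        (deriv (fun s : ℝ => u c s x) t * deriv (fun s : ℝ => φ (s, x)) t -
          (fderiv ℝ (u c t) x (1, 0) * fderiv ℝ (fun y : ℝ × ℝ => φ (t, y)) x (1, 0) +
           fderiv ℝ (u c t) x (0, 1) * fderiv ℝ (fun y : ℝ × ℝ => φ (t, y)) x (0, 1)))) =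
        0 := by
  intro φ hφ hc hsub
  set k := √(1 - c ^ 2) with hk
  have hkpos : 0 < k := Real.sqrt_pos.2 (by nlinarith)
  have hk2 : k ^ 2 = 1 - c ^ 2 := Real.sq_sqrt (by nlinarith)
  have hφ2 : ContDiff ℝ 2 φ := contDiff_infty.1 hφ 2
  have hφ1 : Differentiable ℝ φ := hφ2.differentiable two_ne_zero
  have hdφ : ∀ v, ContDiff ℝ 1 fun p => fderiv ℝ φ p v := fun v =>
    (hφ2.fderiv_right (by norm_num)).clm_apply contDiff_const
  have hcφ : ∀ v, HasCompactSupport fun p => fderiv ℝ φ p v := fun v => hc.fderiv_apply ℝ v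
  have hsymm : ∀ p v w, fderiv ℝ (fun q => fderiv ℝ φ q v) p w =
      fderiv ℝ (fun q => fderiv ℝ φ q w) p v := by
    intro p v w
    have hd : DifferentiableAt ℝ (fderiv ℝ φ) p :=
      (hφ2.fderiv_right (m := 1) (by norm_num)).differentiable one_ne_zero p
    have h (v w) : fderiv ℝ (fun q => fderiv ℝ φ q v) p w = fderiv ℝ (fderiv ℝ φ) p w v := by
      simp [fderiv_clm_apply hd (differentiableAt_const v)]
    rw [h, h]
    exact hφ2.contDiffAt.isSymmSndFDerivAt (by simp) w v
  let D : ℝ × (ℝ × ℝ) → ℝ := fun p => sqrtRe ((p.2.1 - c * p.1) / k) p.2.2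
  let A : ℝ × (ℝ × ℝ) → ℝ := fun p => sqrtReFst ((p.2.1 - c * p.1) / k) p.2.2
  let B : ℝ × (ℝ × ℝ) → ℝ := fun p => sqrtReSnd ((p.2.1 - c * p.1) / k) p.2.2
  have hD : Continuous D := continuous_sqrtRe.comp (by fun_prop :
    Continuous fun p : ℝ × (ℝ × ℝ) => ((p.2.1 - c * p.1) / k, p.2.2))
  have hmap : Measurable fun p : ℝ × (ℝ × ℝ) => ((p.2.1 - c * p.1) / k, p.2.2) := by fun_prop
  have hA : Measurable A := measurable_sqrtReFst.comp hmap
  have hB : Measurable B := measurable_sqrtReSnd.comp hmap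
  have hint : ∀ W : ℝ × (ℝ × ℝ) → ℝ, Measurable W →
      (∃ M, ∀ p, p.2.2 ≠ 0 → |W p| ≤ M * (1 / √|p.2.2|)) → ∀ v w, Integrable fun p =>
        W p * fderiv ℝ φ p v + D p * fderiv ℝ (fun q => fderiv ℝ φ q v) p w := by
    rintro W hW ⟨M, hM⟩ v w
    refine (integrable_mul_of_le_one_div_sqrt hW hM (hdφ v).continuous (hcφ v)).add ?_
    exact (hD.mul (((hdφ v).continuous_fderiv one_ne_zero).clm_apply
      continuous_const)).integrable_of_hasCompactSupport ((hcφ v).fderiv_apply ℝ w).mul_left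
  have hAM : ∀ a : ℝ, ∃ M, ∀ p : ℝ × (ℝ × ℝ), p.2.2 ≠ 0 → |a * A p| ≤ M * (1 / √|p.2.2|) :=
    fun a => ⟨|a|, fun p hp => by
      rw [abs_mul]; exact mul_le_mul_of_nonneg_left (abs_sqrtReFst_le _ hp) (abs_nonneg a)⟩
  have hBM : ∃ M, ∀ p : ℝ × (ℝ × ℝ), p.2.2 ≠ 0 → |B p| ≤ M * (1 / √|p.2.2|) :=
    ⟨1, fun p hp => by rw [one_mul]; exact abs_sqrtReSnd_le _ hp⟩
  have it := hint _ (hA.const_mul (-c / k)) (hAM (-c / k)) (0, 0, 1) (1, 0)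
  have i1 := hint _ (hA.const_mul (1 / k)) (hAM (1 / k)) (0, 0, 1) (0, 1, 0)
  have i2 := fun v => hint _ hB hBM v (0, 0, 1)
  have zt := integral_deriv_time_eq_zero hD (hdφ _) (hcφ _) (fun p hp => by
    have h : HasDerivAt (fun s => (p.2.1 - c * s) / k) (-c / k) p.1 := by
      simpa using (((hasDerivAt_id p.1).const_mul c).const_sub p.2.1).div_const k
    exact ((hasDerivAt_sqrtRe_fst _ hp).comp p.1 h).congr_deriv (mul_comm _ _)) it
  have z1 := integral_deriv_fst_eq_zero hD (hdφ _) (hcφ _) (fun p hp => by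
    have h : HasDerivAt (fun s => (s - c * p.1) / k) (1 / k) p.2.1 :=
      ((hasDerivAt_id p.2.1).sub_const (c * p.1)).div_const k
    exact ((hasDerivAt_sqrtRe_fst _ hp).comp p.2.1 h).congr_deriv (mul_comm _ _)) i1
  have z2 := fun v => integral_deriv_snd_eq_zero (W := B) hD (hdφ v) (hcφ v)
    (fun p hp => hasDerivAt_sqrtRe_snd ((p.2.1 - c * p.1) / k) hp) (i2 v)
  have hslice_t : ∀ t x, deriv (fun s => φ (s, x)) t = fderiv ℝ φ (t, x) (1, 0) := fun t x =>
    ((hφ1 (t, x)).hasFDerivAt.comp_hasDerivAt t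
      ((hasDerivAt_id t).prodMk (hasDerivAt_const t x))).deriv
  have hslice_x : ∀ t x v, fderiv ℝ (fun y => φ (t, y)) x v = fderiv ℝ φ (t, x) (0, v) := by
    intro t x v
    have := ((hφ1 (t, x)).hasFDerivAt.comp x
      ((hasFDerivAt_const t x).prodMk (hasFDerivAt_id x))).fderiv
    exact (DFunLike.congr_fun this v).trans (by simp)
  simp only [hslice_t, hslice_x]
  have hzero : ∀ t x, (t, x) ∉ Set.Ioo (0 : ℝ) T ×ˢ Omega R → fderiv ℝ φ (t, x) = 0 :=
    fun t x h => fderiv_of_notMem_tsupport ℝ fun h' => h (hsub h')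
  have hx : ∀ t, ∀ x ∉ Omega R, fderiv ℝ φ (t, x) = 0 := fun t x h => hzero t x fun h' => h h'.2
  have ht : ∀ t ∉ Set.Ioo (0 : ℝ) T, ∀ x, fderiv ℝ φ (t, x) = 0 :=
    fun t h x => hzero t x fun h' => h h'.1
  rw [setIntegral_eq_integral_of_forall_compl_eq_zero fun t h => by simp [ht t h]]
  have hinner : ∀ t, ∫ x in Omega R, (deriv (fun s : ℝ => u c s x) t * fderiv ℝ φ (t, x) (1, 0) -
      (fderiv ℝ (u c t) x (1, 0) * fderiv ℝ φ (t, x) (0, 1, 0) +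
        fderiv ℝ (u c t) x (0, 1) * fderiv ℝ φ (t, x) (0, 0, 1))) =
      ∫ x, (fun p => 2 / √Real.pi * (1 / √2) / k * (c * (
        (B p * fderiv ℝ φ p (1, 0) + D p * fderiv ℝ (fun q => fderiv ℝ φ q (1, 0)) p (0, 0, 1)) -
        (-c / k * A p * fderiv ℝ φ p (0, 0, 1) +
          D p * fderiv ℝ (fun q => fderiv ℝ φ q (0, 0, 1)) p (1, 0))) + (
        (B p * fderiv ℝ φ p (0, 1, 0) +
          D p * fderiv ℝ (fun q => fderiv ℝ φ q (0, 1, 0)) p (0, 0, 1)) -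
        (1 / k * A p * fderiv ℝ φ p (0, 0, 1) +
          D p * fderiv ℝ (fun q => fderiv ℝ φ q (0, 0, 1)) p (0, 1, 0))))) (t, x) := by
    intro t
    rw [setIntegral_eq_integral_of_forall_compl_eq_zero fun x h => by simp [hx t x h]]
    refine integral_congr_ae ?_
    filter_upwards [ae_snd_ne_zero] with x hx2
    rw [deriv_u_time c t hx2, fderiv_u_fst c t hx2, fderiv_u_snd c t hx2,
      hsymm _ (0, 0, 1) (1, 0), hsymm _ (0, 0, 1) (0, 1, 0), ← hk]
    simp only [A, B]
    field_simp
    linear_combination (-(sqrtReFst ((x.1 - c * t) / k) x.2 * fderiv ℝ φ (t, x) (0, 0, 1))) * hk2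
  simp only [hinner]
  have iT := ((i2 (1, 0)).sub it).const_mul c
  have iX := (i2 (0, 1, 0)).sub i1
  have itot := (iT.add iX).const_mul (2 / √Real.pi * (1 / √2) / k)
  refine (integral_prod _ itot).symm.trans ?_
  rw [← Measure.volume_eq_prod, integral_const_mul]
  refine mul_eq_zero_of_right _ ((integral_add iT iX).trans ?_)
  rw [integral_const_mul]
  refine (congrArg₂ (fun a b => c * a + b) (integral_sub (i2 (1, 0)) it)
    (integral_sub (i2 (0, 1, 0)) i1)).trans ?_
  simp only [zt, z1, z2]
  ring
end

section
/- The forcing term of the damped equation is square-integrable: let $\Psi:[0,T]\times\mathbb{R}^2\to\mathbb{R}$ be bounded, assume that for every $t\in[0,T]$ the function $\Psi(t,\cdot)$ is differentiable on $\Omega$ with $\|\nabla_x\Psi(t,x)\|\le L$ for all $x\in\Omega$ and some constant $L$, and assume there exists $\epsilon$ with $0<\epsilon<R-cT$ such that $\Psi(t,x)=0$ whenever $|x-(ct,0)|<\epsilon$. Then for every $t\in[0,T]$ the function $x\mapsto 2\,\Psi(t,x)\,\nabla_x\Psi(t,x)\cdot\nabla_x\partial_t u(t,x)+\Psi(t,x)^2\,\big(\partial_{11}\partial_t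 u(t,x)+\partial_{22}\partial_t u(t,x)\big)$ (equal to $\operatorname{div}(\Psi^2(t)\nabla\partial_t u(t))=-f(t)$) is square-integrable on $\Omega\setminus\Gamma_t$. -/
open MeasureTheory

/-- The velocity `∂ₜu(t,·)` as a spatial function. -/
noncomputable def v (c t : ℝ) : ℝ × ℝ → ℝ := fun x =>
  deriv (fun s : ℝ => u c s x) t

/-- `S` is the imaginary part of the principal square root. -/
theorem S_eq_im_cpow {z : ℂ} (hz : z ∈ Complex.slitPlane) :
    S (z.re, z.im) = (z ^ ((1 / 2 : ℝ) : ℂ)).im := by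
  have he : ((1 / 2 : ℝ) : ℂ) = 2⁻¹ := by push_cast; norm_num
  have hpos : 0 < ‖z‖ + z.re := by
    rcases hz with h | h
    · positivity
    · have := Complex.abs_re_lt_norm.2 h
      linarith [neg_abs_le z.re]
  have hre : (z ^ (2⁻¹ : ℂ)).re = √(‖z‖ + z.re) / √2 := by
    rw [Complex.cpow_inv_two_re, Real.sqrt_div hpos.le]
  have hsq : (z ^ (2⁻¹ : ℂ)) ^ 2 = z := by
    exact Complex.cpow_nat_inv_pow z (n := 2) two_ne_zero
  have him : 2 * (z ^ (2⁻¹ : ℂ)).re * (z ^ (2⁻¹ : ℂ)).im = z.im := by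
    conv_rhs => rw [← hsq, sq, Complex.mul_im]
    ring
  have hn : √(z.re ^ 2 + z.im ^ 2) = ‖z‖ := by
    rw [Complex.norm_def, Complex.normSq_apply, sq, sq]
  have hs : 0 < √(‖z‖ + z.re) := Real.sqrt_pos.2 hpos
  have h2 : √2 * √2 = (2 : ℝ) := Real.mul_self_sqrt (by norm_num)
  simp only [S]
  rw [he, hn, ← him, hre]
  generalize (z ^ (2⁻¹ : ℂ)).im = q
  field_simp
  linear_combination (-q) * h2

/-- The Lorentz-contracted complex coordinate centred at the crack tip. -/
noncomputable def tipCoord (c t : ℝ) (x : ℝ × ℝ) : ℂ :=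
  ⟨(x.1 - c * t) / √(1 - c ^ 2), x.2⟩

/-- The linear part of `tipCoord`. -/
noncomputable def tipCoordLinear (c : ℝ) : ℝ × ℝ →L[ℝ] ℂ :=
  Complex.equivRealProdCLM.symm.toContinuousLinearMap.comp
    (((√(1 - c ^ 2))⁻¹ • ContinuousLinearMap.fst ℝ ℝ ℝ).prod (ContinuousLinearMap.snd ℝ ℝ ℝ))

theorem tipCoord_eq (c t : ℝ) (x : ℝ × ℝ) :
    tipCoord c t x = tipCoordLinear c x + ((-(c * t) / √(1 - c ^ 2) : ℝ) : ℂ) := by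
  apply Complex.ext
  · simp [tipCoord, tipCoordLinear]
    ring
  · simp [tipCoord, tipCoordLinear]

theorem hasFDerivAt_tipCoord (c t : ℝ) (x : ℝ × ℝ) :
    HasFDerivAt (tipCoord c t) (tipCoordLinear c) x := by
  rw [funext (tipCoord_eq c t)]
  exact (tipCoordLinear c).hasFDerivAt.add_const _

theorem eventually_tipCoord_mem_slitPlane {c t : ℝ} {x : ℝ × ℝ}
    (hx : tipCoord c t x ∈ Complex.slitPlane) :
    ∀ᶠ y in nhds x, tipCoord c t y ∈ Complex.slitPlane :=
  (hasFDerivAt_tipCoord c t x).continuousAt.eventually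
    (Complex.isOpen_slitPlane.mem_nhds hx)

theorem fderiv_im_mul_cpow_tipCoord {c t : ℝ} {x : ℝ × ℝ}
    (hx : tipCoord c t x ∈ Complex.slitPlane) (k : ℂ) (s : ℝ) (h : ℝ × ℝ) :
    fderiv ℝ (fun y => (k * tipCoord c t y ^ (s : ℂ)).im) x h =
      (k * s * tipCoordLinear c h * tipCoord c t x ^ ((s - 1 : ℝ) : ℂ)).im := by
  have h1 : HasDerivAt (fun z : ℂ => k * z ^ (s : ℂ))
      (k * (s * tipCoord c t x ^ ((s : ℂ) - 1) * 1)) (tipCoord c t x) :=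
    ((hasDerivAt_id (tipCoord c t x)).cpow_const hx).const_mul k
  have h2 := (h1.hasFDerivAt.restrictScalars ℝ).comp x (hasFDerivAt_tipCoord c t x)
  have h3 := (Complex.imCLM.hasFDerivAt (x := k * tipCoord c t x ^ (s : ℂ))).comp x h2
  have h4 : HasFDerivAt (fun y => (k * tipCoord c t y ^ (s : ℂ)).im) _ x := h3
  rw [h4.fderiv]
  simp only [ContinuousLinearMap.comp_apply, Complex.imCLM_apply,
    ContinuousLinearMap.coe_restrictScalars', ContinuousLinearMap.toSpanSingleton_apply,
    smul_eq_mul]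
  congr 1
  push_cast
  ring

theorem v_eq_im_cpow {c t : ℝ} {x : ℝ × ℝ} (hx : tipCoord c t x ∈ Complex.slitPlane) :
    v c t x = (((2 / √Real.pi * (1 / 2) * (-c / √(1 - c ^ 2)) : ℝ) : ℂ) *
      tipCoord c t x ^ ((-1 / 2 : ℝ) : ℂ)).im := by
  have hW : HasDerivAt (fun s : ℝ => tipCoord c s x) ((-c / √(1 - c ^ 2) : ℝ) : ℂ) t := by
    have h1 : HasDerivAt (fun s : ℝ => -(c * s) / √(1 - c ^ 2)) (-c / √(1 - c ^ 2)) t := by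
      simpa using (((hasDerivAt_id t).const_mul c).neg.div_const (√(1 - c ^ 2)))
    simp only [tipCoord_eq]
    exact h1.ofReal_comp.const_add _
  have hu : (fun s : ℝ => u c s x) =ᶠ[nhds t]
      fun s => 2 / √Real.pi * (tipCoord c s x ^ ((1 / 2 : ℝ) : ℂ)).im := by
    filter_upwards [hW.continuousAt.eventually (Complex.isOpen_slitPlane.mem_nhds hx)] with s hs
    rw [← S_eq_im_cpow hs]
    rfl
  have h1 : HasDerivAt (fun z : ℂ => z ^ ((1 / 2 : ℝ) : ℂ))
      (((1 / 2 : ℝ) : ℂ) * tipCoord c t x ^ (((1 / 2 : ℝ) : ℂ) - 1) * 1) (tipCoord c t x) :=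
    (hasDerivAt_id (tipCoord c t x)).cpow_const hx
  have h2 := h1.comp t hW
  have h3 := ((Complex.imCLM.hasFDerivAt (x := tipCoord c t x ^ ((1 / 2 : ℝ) : ℂ))).comp_hasDerivAt
    t h2).const_mul (2 / √Real.pi)
  have h4 : HasDerivAt (fun s => 2 / √Real.pi * (tipCoord c s x ^ ((1 / 2 : ℝ) : ℂ)).im) _ t := h3
  have he : ((1 / 2 : ℝ) : ℂ) - 1 = ((-1 / 2 : ℝ) : ℂ) := by push_cast; norm_num
  rw [v, hu.deriv_eq, h4.deriv, Complex.imCLM_apply, he, ← Complex.im_ofReal_mul]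
  congr 1
  push_cast
  ring

theorem abs_im_mul_cpow_le {ε s : ℝ} (hε : 0 < ε) (hs : s ≤ 0) {z : ℂ} (hz : ε ≤ ‖z‖) (k : ℂ) :
    |(k * z ^ (s : ℂ)).im| ≤ ‖k‖ * ε ^ s := by
  refine (Complex.abs_im_le_norm _).trans ?_
  rw [norm_mul, Complex.norm_cpow_real]
  exact mul_le_mul_of_nonneg_left (Real.rpow_le_rpow_of_nonpos hε hz hs) (norm_nonneg k)

/-- First and second derivatives of `v` are bounded away from the crack tip. -/
theorem exists_bound_fderiv_v (c t : ℝ) {ε : ℝ} (hε : 0 < ε) (h : ℝ × ℝ) :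
    ∃ M, ∀ x, tipCoord c t x ∈ Complex.slitPlane → ε ≤ ‖tipCoord c t x‖ →
      |fderiv ℝ (v c t) x h| ≤ M ∧
      |fderiv ℝ (fun y => fderiv ℝ (v c t) y h) x h| ≤ M := by
  set k : ℂ := ((2 / √Real.pi * (1 / 2) * (-c / √(1 - c ^ 2)) : ℝ) : ℂ)
  set k₁ : ℂ := k * ((-1 / 2 : ℝ) : ℂ) * tipCoordLinear c h
  set k₂ : ℂ := k₁ * ((-1 / 2 - 1 : ℝ) : ℂ) * tipCoordLinear c h
  have hfst : ∀ x, tipCoord c t x ∈ Complex.slitPlane →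
      fderiv ℝ (v c t) x h = (k₁ * tipCoord c t x ^ ((-1 / 2 - 1 : ℝ) : ℂ)).im := by
    intro x hx
    have hv : v c t =ᶠ[nhds x] fun y => (k * tipCoord c t y ^ ((-1 / 2 : ℝ) : ℂ)).im :=
      (eventually_tipCoord_mem_slitPlane hx).mono fun y hy => v_eq_im_cpow hy
    rw [hv.fderiv_eq, fderiv_im_mul_cpow_tipCoord hx]
  refine ⟨max (‖k₁‖ * ε ^ (-1 / 2 - 1 : ℝ)) (‖k₂‖ * ε ^ (-1 / 2 - 1 - 1 : ℝ)),
    fun x hx hxε => ⟨?_, ?_⟩⟩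
  · rw [hfst x hx]
    exact (abs_im_mul_cpow_le hε (by norm_num) hxε _).trans (le_max_left _ _)
  · have hv : (fun y => fderiv ℝ (v c t) y h) =ᶠ[nhds x]
        fun y => (k₁ * tipCoord c t y ^ ((-1 / 2 - 1 : ℝ) : ℂ)).im :=
      (eventually_tipCoord_mem_slitPlane hx).mono hfst
    rw [hv.fderiv_eq, fderiv_im_mul_cpow_tipCoord hx]
    exact (abs_im_mul_cpow_le hε (by norm_num) hxε _).trans (le_max_right _ _)

theorem tipCoord_mem_slitPlane {R c t : ℝ} (hc0 : 0 < c) (hc1 : c < 1) {x : ℝ × ℝ}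
    (hx : x ∈ Omega R \ Crack R c t) : tipCoord c t x ∈ Complex.slitPlane := by
  have ha : 0 < √(1 - c ^ 2) := Real.sqrt_pos.2 (by nlinarith)
  by_cases h : x.2 = 0
  · have h1 : c * t < x.1 := by
      by_contra! h1
      exact hx.2 ⟨le_of_lt hx.1, h, h1⟩
    exact Or.inl (div_pos (sub_pos.2 h1) ha)
  · exact Or.inr h

theorem sqrt_le_norm_tipCoord {c : ℝ} (hc0 : 0 < c) (hc1 : c < 1) (t : ℝ) (x : ℝ × ℝ) :
    √((x.1 - c * t) ^ 2 + x.2 ^ 2) ≤ ‖tipCoord c t x‖ := by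
  have ha : 0 < 1 - c ^ 2 := by nlinarith
  rw [Complex.norm_def, Complex.normSq_apply]
  apply Real.sqrt_le_sqrt
  simp only [tipCoord, ← sq]
  rw [div_pow, Real.sq_sqrt ha.le]
  gcongr
  exact le_div_self (sq_nonneg _) ha (by nlinarith)

theorem isOpen_Omega (R : ℝ) : IsOpen (Omega R) :=
  isOpen_lt (by fun_prop) continuous_const

theorem isClosed_Crack (R c t : ℝ) : IsClosed (Crack R c t) :=
  (isClosed_le (f := fun x : ℝ × ℝ => √(x.1 ^ 2 + x.2 ^ 2)) (by fun_prop) continuous_const).inter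
    ((isClosed_eq continuous_snd continuous_const).inter
      (isClosed_le continuous_fst continuous_const))

theorem volume_Omega_lt_top (R : ℝ) : volume (Omega R) < ⊤ := by
  refine (measure_mono fun x hx => ?_).trans_lt
    (measure_closedBall_lt_top (x := (0 : ℝ × ℝ)) (r := R))
  have hx' : √(x.1 ^ 2 + x.2 ^ 2) < R := hx
  rw [mem_closedBall_zero_iff, Prod.norm_def, max_le_iff, Real.norm_eq_abs, Real.norm_eq_abs]
  exact ⟨(Real.abs_le_sqrt (by nlinarith [sq_nonneg x.2])).trans hx'.le,
    (Real.abs_le_sqrt (by nlinarith [sq_nonneg x.1])).trans hx'.le⟩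

theorem abs_forcing_le {C L M₁ M₂ p p₁ p₂ d₁ d₂ e₁ e₂ : ℝ} (hp : |p| ≤ C)
    (hp₁ : |p₁| ≤ L) (hp₂ : |p₂| ≤ L) (hd₁ : |d₁| ≤ M₁) (hd₂ : |d₂| ≤ M₂)
    (he₁ : |e₁| ≤ M₁) (he₂ : |e₂| ≤ M₂) :
    |2 * p * (p₁ * d₁ + p₂ * d₂) + p ^ 2 * (e₁ + e₂)| ≤
      2 * C * (L * M₁ + L * M₂) + C ^ 2 * (M₁ + M₂) := by
  have hC := (abs_nonneg p).trans hp
  have hL := (abs_nonneg p₁).trans hp₁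
  have hM₁ := (abs_nonneg d₁).trans hd₁
  have hM₂ := (abs_nonneg d₂).trans hd₂
  calc _ ≤ |2 * p * (p₁ * d₁ + p₂ * d₂)| + |p ^ 2 * (e₁ + e₂)| := abs_add_le _ _
    _ = 2 * |p| * |p₁ * d₁ + p₂ * d₂| + |p| ^ 2 * |e₁ + e₂| := by
      simp only [abs_mul, abs_pow, abs_two]
    _ ≤ 2 * |p| * (|p₁| * |d₁| + |p₂| * |d₂|) + |p| ^ 2 * (|e₁| + |e₂|) := by
      gcongr
      · simpa only [abs_mul] using abs_add_le (p₁ * d₁) (p₂ * d₂)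
      · exact abs_add_le _ _
    _ ≤ _ := by gcongr

/-- The forcing term of the damped equation is square-integrable: if `Ψ` is bounded,
spatially differentiable on `Ω` with `‖∇ₓΨ(t,x)‖ ≤ L`, and vanishes on an
`ε`-neighborhood of the crack tip `(ct,0)` for some `0 < ε < R - cT`, then
`x ↦ 2Ψ∇ₓΨ·∇ₓ∂ₜu + Ψ²(∂₁₁∂ₜu + ∂₂₂∂ₜu)` (equal to `div(Ψ²(t)∇∂ₜu(t)) = -f(t)`) is
square-integrable on `Ω \ Γ_t` for every `t ∈ [0,T]`. -/
theorem forcing_term_square_integrable (c T R : ℝ) (hc0 : 0 < c) (hc1 : c < 1)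
    (hT : 0 < T) (hR : c * T < R) (Ψ : ℝ → ℝ × ℝ → ℝ)
    (hbdd : ∃ C : ℝ, ∀ t ∈ Set.Icc (0 : ℝ) T, ∀ x : ℝ × ℝ, |Ψ t x| ≤ C)
    (L : ℝ)
    (hdiff : ∀ t ∈ Set.Icc (0 : ℝ) T, ∀ x ∈ Omega R,
      DifferentiableAt ℝ (Ψ t) x ∧
      Real.sqrt ((fderiv ℝ (Ψ t) x (1, 0)) ^ 2 + (fderiv ℝ (Ψ t) x (0, 1)) ^ 2) ≤ L)
    (hvanish : ∃ ε : ℝ, 0 < ε ∧ ε < R - c * T ∧ ∀ t ∈ Set.Icc (0 : ℝ) T, ∀ x : ℝ × ℝ,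
      Real.sqrt ((x.1 - c * t) ^ 2 + x.2 ^ 2) < ε → Ψ t x = 0) :
    ∀ t ∈ Set.Icc (0 : ℝ) T,
      IntegrableOn
        (fun x : ℝ × ℝ =>
          (2 * Ψ t x *
              (fderiv ℝ (Ψ t) x (1, 0) * fderiv ℝ (v c t) x (1, 0) +
               fderiv ℝ (Ψ t) x (0, 1) * fderiv ℝ (v c t) x (0, 1)) +
            (Ψ t x) ^ 2 *
              (fderiv ℝ (fun y : ℝ × ℝ => fderiv ℝ (v c t) y (1, 0)) x (1, 0) +
               fderiv ℝ (fun y : ℝ × ℝ => fderiv ℝ (v c t) y (0, 1)) x (0, 1))) ^ 2)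
        (Omega R \ Crack R c t) volume := by
  intro t ht
  obtain ⟨C, hC⟩ := hbdd
  obtain ⟨ε, hε, -, hvan⟩ := hvanish
  obtain ⟨M₁, hM₁⟩ := exists_bound_fderiv_v c t hε (1, 0)
  obtain ⟨M₂, hM₂⟩ := exists_bound_fderiv_v c t hε (0, 1)
  have hmeas : MeasurableSet (Omega R \ Crack R c t) :=
    (isOpen_Omega R).measurableSet.diff (isClosed_Crack R c t).measurableSet
  have hΨ : AEMeasurable (Ψ t) (volume.restrict (Omega R \ Crack R c t)) :=
    ContinuousOn.aemeasurable
      (fun x hx => (hdiff t ht x hx.1).1.continuousAt.continuousWithinAt) hmeas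
  have hD (f : ℝ × ℝ → ℝ) (h : ℝ × ℝ) :
      AEMeasurable (fun x => fderiv ℝ f x h) (volume.restrict (Omega R \ Crack R c t)) :=
    (measurable_fderiv_apply_const ℝ f h).aemeasurable
  have hfin : IsFiniteMeasure (volume.restrict (Omega R \ Crack R c t)) :=
    isFiniteMeasure_restrict.2
      ((measure_mono Set.sdiff_subset).trans_lt (volume_Omega_lt_top R)).ne
  refine Integrable.of_bound (C := (2 * C * (L * M₁ + L * M₂) + C ^ 2 * (M₁ + M₂)) ^ 2) ?_ ?_
  · exact ((((hΨ.const_mul 2).mul (((hD _ _).mul (hD _ _)).add ((hD _ _).mul (hD _ _)))).add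
      ((hΨ.pow_const 2).mul ((hD _ _).add (hD _ _)))).pow_const 2).aestronglyMeasurable
  · refine (ae_restrict_iff' hmeas).2 (Filter.Eventually.of_forall fun x hx => ?_)
    rcases lt_or_ge (√((x.1 - c * t) ^ 2 + x.2 ^ 2)) ε with hlt | hge
    · simp only [hvan t ht x hlt]
      simpa using sq_nonneg (2 * C * (L * M₁ + L * M₂) + C ^ 2 * (M₁ + M₂))
    · have hslit := tipCoord_mem_slitPlane hc0 hc1 hx
      have hfar := hge.trans (sqrt_le_norm_tipCoord hc0 hc1 t x)
      have hgrad := (hdiff t ht x hx.1).2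
      rw [Real.norm_eq_abs, abs_pow]
      refine pow_le_pow_left₀ (abs_nonneg _) (abs_forcing_le (hC t ht x) ?_ ?_
        (hM₁ x hslit hfar).1 (hM₂ x hslit hfar).1 (hM₁ x hslit hfar).2 (hM₂ x hslit hfar).2) 2
      · exact (Real.abs_le_sqrt (le_add_of_nonneg_right (sq_nonneg _))).trans hgrad
      · exact (Real.abs_le_sqrt (le_add_of_nonneg_left (sq_nonneg _))).trans hgrad
end
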